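/- For all rational numbers u and k, if k² = u⁴ + 14u² + 1 then u = 0 or u = 1 or u = −1. (In particular, taking u = t², the only rational points on k² = t⁸ + 14t⁴ + 1 have t ∈ {0, 1, −1}, which are degenerate parameter values in the analysis of the families parameterizing A₃(D₂) and A₄(D₃).) -/

import Mathlib

/-- A three-term relation between squares of coprime integers that arises in the descent. -/
lemma sq_add_sq_eq_of_mul_sq_eq_mul_sq {a b c d : ℤ} (had : IsCoprime a d) (hcb : IsCoprime c b)
    (hb : b ≠ 0) (h : b ^ 2 * (a ^ 2 + d ^ 2) = c ^ 2 * (a ^ 2 + 4 * d ^ 2)) :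
    a ^ 2 + d ^ 2 = c ^ 2 ∧ a ^ 2 + 4 * d ^ 2 = b ^ 2 := by
  obtain ⟨k, hk⟩ : b ^ 2 ∣ a ^ 2 + 4 * d ^ 2 :=
    (hcb.symm.pow (m := 2) (n := 2)).dvd_of_dvd_mul_left ⟨_, h.symm⟩
  have hk' : a ^ 2 + d ^ 2 = k * c ^ 2 := by
    apply mul_left_cancel₀ (pow_ne_zero 2 hb)
    rw [h, hk]
    ring
  obtain ⟨x, y, hxy⟩ := had.pow (m := 2) (n := 2)
  have hk3 : k ∣ 3 :=
    ⟨x * (4 * c ^ 2 - b ^ 2) + y * (b ^ 2 - c ^ 2), by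
      linear_combination (-3) * hxy + (4 * x - y) * hk' + (y - x) * hk⟩
  have hpos : 0 < k := by
    have hsq : 0 < a ^ 2 + 4 * d ^ 2 := by
      by_contra! hle
      have ha : a ^ 2 = 0 := by nlinarith [sq_nonneg a, sq_nonneg d]
      have hd : d ^ 2 = 0 := by nlinarith [sq_nonneg a, sq_nonneg d]
      simp [ha, hd] at hxy
    by_contra! hle
    nlinarith [mul_nonneg (sq_nonneg b) (neg_nonneg.mpr hle)]
  have hle := Int.le_of_dvd (by norm_num) hk3
  have hk_ne : k ≠ 3 := by
    rintro rfl
    have hdvd : (3 : ℤ) ∣ a ∧ (3 : ℤ) ∣ d := by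
      have h3 : (a ^ 2 + d ^ 2) % 3 = 0 := by omega
      have ha3 : a % 3 = 0 ∨ a % 3 = 1 ∨ a % 3 = 2 := by omega
      have hd3 : d % 3 = 0 ∨ d % 3 = 1 ∨ d % 3 = 2 := by omega
      rcases ha3 with h1 | h1 | h1 <;> rcases hd3 with h2 | h2 | h2 <;>
        simp [pow_two, Int.add_emod, Int.mul_emod, h1, h2] at h3
      omega
    have := had.isUnit_of_dvd' hdvd.1 hdvd.2
    rw [Int.isUnit_iff] at this
    omega
  have hk1 : k = 1 := by
    interval_cases k <;> omega
  subst hk1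
  constructor <;> linarith

/-- Two Pythagorean-type parametrisations of the same pair yield a smaller solution of
`r ^ 4 + 14 * r ^ 2 * s ^ 2 + s ^ 4 = z ^ 2`. -/
lemma exists_smaller_quartic_solution {r s m n : ℤ} (hrs : IsCoprime r s) (hm : m % 2 = 1)
    (hr : r % 2 = 1) (hs : s ≠ 0) (hmul : r * s = m * n)
    (hsub : r ^ 2 - s ^ 2 = m ^ 2 - (2 * n) ^ 2) :
    ∃ r' s' z : ℤ, IsCoprime r' s' ∧ (r' + s') % 2 = 1 ∧ r' * s' ≠ 0 ∧
      r' ^ 4 + 14 * r' ^ 2 * s' ^ 2 + s' ^ 4 = z ^ 2 ∧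
      (r' * s').natAbs < (r * s).natAbs := by
  have hr0 : r ≠ 0 := by omega
  have hm0 : m ≠ 0 := by omega
  obtain ⟨a, c, b, ha, hcb, rfl, rfl⟩ : ∃ a c b : ℤ, a ≠ 0 ∧ IsCoprime c b ∧
      r = a * c ∧ m = a * b := by
    have hg : (Int.gcd r m : ℤ) ≠ 0 := by
      exact_mod_cast (Int.gcd_pos_of_ne_zero_left m hr0).ne'
    refine ⟨Int.gcd r m, r / Int.gcd r m, m / Int.gcd r m, hg, ?_,
      (Int.mul_ediv_cancel' (Int.gcd_dvd_left _ _)).symm,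
      (Int.mul_ediv_cancel' (Int.gcd_dvd_right _ _)).symm⟩
    rw [Int.isCoprime_iff_gcd_eq_one]
    exact Int.gcd_ediv_gcd_ediv_gcd (Int.gcd_pos_of_ne_zero_left m hr0)
  have hb : b ≠ 0 := right_ne_zero_of_mul hm0
  have hc : c ≠ 0 := right_ne_zero_of_mul hr0
  have hcs : c * s = b * n := mul_left_cancel₀ ha (by linear_combination hmul)
  obtain ⟨d, rfl⟩ : c ∣ n := hcb.dvd_of_dvd_mul_left ⟨s, hcs.symm⟩
  obtain rfl : s = b * d := mul_left_cancel₀ hc (by linear_combination hcs)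
  have had : IsCoprime a d := hrs.of_mul_left_left.of_mul_right_right
  obtain ⟨h1, h2⟩ := sq_add_sq_eq_of_mul_sq_eq_mul_sq had hcb hb (by linear_combination -hsub)
  have hd0 : d ≠ 0 := right_ne_zero_of_mul hs
  have haodd : a % 2 = 1 := Int.odd_iff.mp (Int.odd_mul.mp (Int.odd_iff.mpr hm)).1
  have htriple : PythagoreanTriple a d |c| := by
    unfold PythagoreanTriple
    rw [abs_mul_abs_self]
    linear_combination h1
  obtain ⟨r', s', har, hds, -, hgcd, hpar, -⟩ := htriple.coprime_classification'
    (Int.isCoprime_iff_gcd_eq_one.mp had) haodd (abs_pos.mpr hc)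
  have hrs0 : r' * s' ≠ 0 := by
    intro h0
    exact hd0 (by linear_combination hds + 2 * h0)
  refine ⟨r', s', b, Int.isCoprime_iff_gcd_eq_one.mpr hgcd, by omega, hrs0, ?_, ?_⟩
  · rw [← h2, har, hds]
    ring
  · have hfac : a * c * (b * d) = (2 * (a * c * b)) * (r' * s') := by rw [hds]; ring
    rw [hfac, Int.natAbs_mul (2 * _)]
    have hpos : 0 < (r' * s').natAbs := Int.natAbs_pos.mpr hrs0
    have habc : 0 < (a * c * b).natAbs :=
      Int.natAbs_pos.mpr (mul_ne_zero (mul_ne_zero ha hc) hb)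
    rw [Int.natAbs_mul 2, show (2 : ℤ).natAbs = 2 from rfl]
    nlinarith

/-- If `r` is odd and `s` is even, then so are the parameters of any representation of
`r ^ 2 - s ^ 2` as a difference of squares. -/
lemma odd_and_even_of_sq_sub_sq_eq {r s m n : ℤ} (hr : r % 2 = 1) (hs : s % 2 = 0)
    (h : r ^ 2 - s ^ 2 = m ^ 2 - n ^ 2) : m % 2 = 1 ∧ n % 2 = 0 := by
  have h4 : (r ^ 2 - s ^ 2) % 4 = 1 := by
    obtain ⟨x, rfl⟩ : ∃ x, r = 2 * x + 1 := ⟨r / 2, by omega⟩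
    obtain ⟨y, rfl⟩ : ∃ y, s = 2 * y := ⟨s / 2, by omega⟩
    ring_nf
    omega
  rw [h] at h4
  obtain ⟨x, hx | hx⟩ : ∃ x, m = 2 * x ∨ m = 2 * x + 1 := ⟨m / 2, by omega⟩ <;>
    obtain ⟨y, hy | hy⟩ : ∃ y, n = 2 * y ∨ n = 2 * y + 1 := ⟨n / 2, by omega⟩ <;>
    subst hx hy <;> ring_nf at h4 <;> omega

lemma isCoprime_sq_sub_sq_mul {r s : ℤ} (h : IsCoprime r s) :
    IsCoprime (r ^ 2 - s ^ 2) (r * s) := by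
  refine IsCoprime.mul_right ?_ ?_
  · rw [show r ^ 2 - s ^ 2 = -s ^ 2 + r * r by ring]
    exact h.symm.pow_left.neg_left.add_mul_left_left r
  · rw [show r ^ 2 - s ^ 2 = r ^ 2 + s * -s by ring]
    exact h.pow_left.add_mul_left_left (-s)

/-- Coprime integers of opposite parity with nonzero product do not solve
`r ^ 4 + 14 * r ^ 2 * s ^ 2 + s ^ 4 = z ^ 2`. -/
lemma quartic_form_ne_sq {r s z : ℤ} (hrs : IsCoprime r s) (hpar : (r + s) % 2 = 1)
    (h0 : r * s ≠ 0) : r ^ 4 + 14 * r ^ 2 * s ^ 2 + s ^ 4 ≠ z ^ 2 := by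
  induction hN : (r * s).natAbs using Nat.strong_induction_on generalizing r s z with
  | _ N ih =>
  intro hz
  wlog hr : r % 2 = 1 generalizing r s
  · exact this hrs.symm (by omega) (by rwa [mul_comm]) (by rwa [mul_comm])
      (by linear_combination hz) (by omega)
  have hs : s % 2 = 0 := by omega
  have hodd : (r ^ 2 - s ^ 2) % 2 = 1 := by
    rw [sq, sq, Int.sub_emod, Int.mul_emod, Int.mul_emod s, hr, hs]
    norm_num
  have hcop : IsCoprime (r ^ 2 - s ^ 2) (4 * (r * s)) := by
    refine IsCoprime.mul_right ?_ (isCoprime_sq_sub_sq_mul hrs)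
    have h2 : IsCoprime (r ^ 2 - s ^ 2) 2 := ⟨1, -((r ^ 2 - s ^ 2) / 2), by omega⟩
    exact h2.pow_right (n := 2)
  have hz0 : z ≠ 0 := by
    rintro rfl
    have := mul_self_pos.mpr h0
    nlinarith [sq_nonneg (r ^ 2), sq_nonneg (s ^ 2)]
  have htriple : PythagoreanTriple (r ^ 2 - s ^ 2) (4 * (r * s)) |z| := by
    unfold PythagoreanTriple
    rw [abs_mul_abs_self]
    linear_combination hz
  obtain ⟨m, n, hsub, hmul, -⟩ := htriple.coprime_classification'
    (Int.isCoprime_iff_gcd_eq_one.mp hcop) hodd (abs_pos.mpr hz0)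
  obtain ⟨hm, hn⟩ := odd_and_even_of_sq_sub_sq_eq hr hs hsub
  obtain ⟨n', rfl⟩ : ∃ n', n = 2 * n' := ⟨n / 2, by omega⟩
  obtain ⟨r', s', z', hrs', hpar', h0', hz', hlt⟩ := exists_smaller_quartic_solution hrs hm hr
    (right_ne_zero_of_mul h0) (by linarith) hsub
  exact ih _ (hN ▸ hlt) hrs' hpar' h0' rfl hz'

/-- Coprime integers of opposite parity with nonzero product do not solve
`p ^ 4 - p ^ 2 * q ^ 2 + q ^ 4 = z ^ 2`. -/
lemma quartic_form_ne_sq' {p q z : ℤ} (hpq : IsCoprime p q) (hpar : (p + q) % 2 = 1)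
    (h0 : p * q ≠ 0) : p ^ 4 - p ^ 2 * q ^ 2 + q ^ 4 ≠ z ^ 2 := by
  intro hz
  wlog hp : p % 2 = 1 generalizing p q
  · exact this hpq.symm (by omega) (by rwa [mul_comm]) (by linear_combination hz) (by omega)
  have hq : q % 2 = 0 := by omega
  have hodd : (p ^ 2 - q ^ 2) % 2 = 1 := by
    rw [sq, sq, Int.sub_emod, Int.mul_emod, Int.mul_emod q, hp, hq]
    norm_num
  have hz0 : z ≠ 0 := by
    rintro rfl
    have := mul_self_pos.mpr h0
    nlinarith [sq_nonneg (p ^ 2 - q ^ 2)]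
  have htriple : PythagoreanTriple (p ^ 2 - q ^ 2) (p * q) |z| := by
    unfold PythagoreanTriple
    rw [abs_mul_abs_self]
    linear_combination hz
  obtain ⟨m, n, hsub, hmul, -, hgcd, -⟩ := htriple.coprime_classification'
    (Int.isCoprime_iff_gcd_eq_one.mp (isCoprime_sq_sub_sq_mul hpq)) hodd (abs_pos.mpr hz0)
  obtain ⟨hm, -⟩ := odd_and_even_of_sq_sub_sq_eq hp hq hsub
  obtain ⟨q', rfl⟩ : ∃ q', q = 2 * q' := ⟨q / 2, by omega⟩
  have hn0 : n ≠ 0 := by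
    rintro rfl
    exact h0 (by linarith)
  obtain ⟨r', s', z', hrs', hpar', h0', hz', -⟩ := exists_smaller_quartic_solution
    (Int.isCoprime_iff_gcd_eq_one.mpr hgcd) hp hm hn0 (n := q') (by linarith) hsub.symm
  exact quartic_form_ne_sq hrs' hpar' h0' hz'

/-- The coprime integral solutions of `x ^ 4 + 14 * x ^ 2 * y ^ 2 + y ^ 4 = z ^ 2`. -/
lemma eq_zero_or_eq_of_quartic_form_eq_sq {x y z : ℤ} (hxy : IsCoprime x y)
    (h : x ^ 4 + 14 * x ^ 2 * y ^ 2 + y ^ 4 = z ^ 2) :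
    x * y = 0 ∨ x = y ∨ x = -y := by
  by_cases hpar : (x + y) % 2 = 1
  · by_contra! hne
    exact quartic_form_ne_sq hxy hpar hne.1 h
  right
  obtain ⟨p, q, rfl, rfl⟩ : ∃ p q : ℤ, x = p + q ∧ y = p - q :=
    ⟨(x + y) / 2, (x - y) / 2, by omega, by omega⟩
  have hpq : IsCoprime p q := by
    obtain ⟨a, b, hab⟩ := hxy
    exact ⟨a + b, a - b, by linear_combination hab⟩
  have hpar' : (p + q) % 2 = 1 := by
    by_contra hne
    have := hxy.isUnit_of_dvd' (x := 2) (by omega) (by omega)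
    rw [Int.isUnit_iff] at this
    omega
  obtain ⟨w, rfl⟩ : (4 : ℤ) ∣ z := by
    rw [← Int.pow_dvd_pow_iff two_ne_zero, ← h]
    exact ⟨p ^ 4 - p ^ 2 * q ^ 2 + q ^ 4, by ring⟩
  have hw : p ^ 4 - p ^ 2 * q ^ 2 + q ^ 4 = w ^ 2 := by linarith
  have h0 : p * q = 0 := by
    by_contra hne
    exact quartic_form_ne_sq' hpq hpar' hne hw
  rcases mul_eq_zero.mp h0 with rfl | rfl <;> simp

/-- For all rationals `u, k`, if `k² = u⁴ + 14u² + 1` then `u ∈ {0, 1, −1}`. -/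
theorem quartic_curve_rational_points (u k : ℚ)
    (h : k ^ 2 = u ^ 4 + 14 * u ^ 2 + 1) :
    u = 0 ∨ u = 1 ∨ u = -1 := by
  have hd : (u.den : ℚ) ≠ 0 := by exact_mod_cast u.den_nz
  have hu : u * u.den = u.num := Rat.mul_den_eq_num u
  have hsq : IsSquare
      ((u.num ^ 4 + 14 * u.num ^ 2 * (u.den : ℤ) ^ 2 + (u.den : ℤ) ^ 4 : ℤ) : ℚ) := by
    refine ⟨k * (u.den : ℚ) ^ 2, ?_⟩
    push_cast
    rw [← hu]
    linear_combination (-(u.den : ℚ) ^ 4) * h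
  obtain ⟨z, hz⟩ := Rat.isSquare_intCast_iff.mp hsq
  have hcop : IsCoprime u.num (u.den : ℤ) := Rat.isCoprime_num_den u
  rcases eq_zero_or_eq_of_quartic_form_eq_sq hcop (hz.trans (sq z).symm) with h1 | h1 | h1
  · left
    simpa using h1
  · right; left
    apply mul_right_cancel₀ hd
    rw [hu, h1]
    simp
  · right; right
    apply mul_right_cancel₀ hd
    rw [hu, h1]
    simp
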